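/- Let g ∈ G and X' ⊆ X. Consider the statements: (U) Problem (P') has a unique solution; (M) {(∂°g)⁻¹(y)}_{y∈ldom(B°g)} is a topologically minimal covering of X' ∩ udom g. Then: (1) if (U) holds and {(∂°g)⁻¹(y)}_{y∈ldom(B°g)} is a covering of X' ∩ udom g, then (M) holds; (2) if (a) either Y is discrete, or b is continuous in the second variable and B°g(y) > −∞ for all y ∈ Y, and (b) either B°g ∈ F_c, or b is coercive and X' ⊆ idom g ∪ g⁻¹(−∞), then (U) ⇒ (M); (3) if moreover, in addition to (a) and (b), B°g is quasi-continuous on its domain, then (U) ⟺ (M). -/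

import Mathlib

noncomputable def Bop {X Y : Type*} (b : X → Y → EReal → EReal) (f : Y → EReal) : X → EReal :=
  fun x => ⨆ y, b x y (f y)

noncomputable def Bgal {X Y : Type*} (bo : Y → X → EReal → EReal) (g : X → EReal) : Y → EReal :=
  fun y => ⨆ x, bo y x (g x)

/-- Subdifferential of `f` at `y` with respect to the kernel `b`. -/
def subdiff {X Y : Type*} (b : X → Y → EReal → EReal) (S : Set (X × Y))
    (f : Y → EReal) (y : Y) : Set X :=
  {x | (x, y) ∈ S ∧ Bop b f x = b x y (f y)}

/-- Subdifferential of `g` at `x` with respect to the kernel `b°`. -/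
def subdiffo {X Y : Type*} (bo : Y → X → EReal → EReal) (S : Set (X × Y))
    (g : X → EReal) (x : X) : Set Y :=
  {y | (x, y) ∈ S ∧ Bgal bo g y = bo y x (g x)}

/-- `(∂°g)⁻¹(y)`. -/
def subdiffoInv {X Y : Type*} (bo : Y → X → EReal → EReal) (S : Set (X × Y))
    (g : X → EReal) (y : Y) : Set X :=
  {x | y ∈ subdiffo bo S g x}

def ldom {Z : Type*} (h : Z → EReal) : Set Z := {z | h z < ⊤}
def udom {Z : Type*} (h : Z → EReal) : Set Z := {z | ⊥ < h z}
def edom {Z : Type*} (h : Z → EReal) : Set Z := ldom h ∩ udom h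
def idom {Z : Type*} [TopologicalSpace Z] (h : Z → EReal) : Set Z :=
  {z | z ∈ edom h ∧ Filter.limsup h (nhds z) < ⊤}

/-- `b` is continuous in the second variable. -/
def Cont2 {X Y : Type*} [TopologicalSpace Y] (b : X → Y → EReal → EReal) : Prop :=
  ∀ (x : X) (α : ℝ), Continuous fun y => b x y (α : EReal)

/-- `b` is coercive. -/
def Coercive {X Y : Type*} [TopologicalSpace X] [TopologicalSpace Y]
    (b : X → Y → EReal → EReal) (bo : Y → X → EReal → EReal) : Prop :=
  ∀ x : X, ∀ V ∈ nhds x, ∀ (α β : ℝ),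
    IsCompact (closure {y : Y | (⨆ z ∈ V, b z y (bo y x (α : EReal))) ≤ (β : EReal)})

/-- `f ∈ F_c`: relatively compact finite superlevel sets. -/
def MemFc {X Y : Type*} [TopologicalSpace Y] (b : X → Y → EReal → EReal)
    (f : Y → EReal) : Prop :=
  ∀ (x : X) (β : ℝ), IsCompact (closure {y : Y | (β : EReal) ≤ b x y (f y)})

/-- `f` solves Problem (P') for the data `g`, `X'`. -/
def IsSolution {X Y : Type*} [TopologicalSpace Y] (b : X → Y → EReal → EReal)
    (g : X → EReal) (X' : Set X) (f : Y → EReal) : Prop :=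
  LowerSemicontinuous f ∧ (∀ x, Bop b f x ≤ g x) ∧ ∀ x ∈ X', Bop b f x = g x

def SemiOpen {Z : Type*} [TopologicalSpace Z] (s : Set Z) : Prop :=
  s ⊆ closure (interior s)

def QuasiContinuous {Z W : Type*} [TopologicalSpace Z] [TopologicalSpace W]
    (h : Z → W) : Prop :=
  ∀ G : Set W, IsOpen G → SemiOpen (h ⁻¹' G)

/-- `h` is quasi-continuous on its domain. -/
def QuasiContinuousOnDom {Z : Type*} [TopologicalSpace Z] (h : Z → EReal) : Prop :=
  QuasiContinuous fun z : edom h => h z.1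

/-- `y` is algebraically essential with respect to the covering of `W'` by `{Fm z}_{z ∈ Z'}`. -/
def AlgEssential {Z W : Type*} (Fm : Z → Set W) (Z' : Set Z) (W' : Set W) (y : Z) : Prop :=
  y ∈ Z' ∧ ∃ w ∈ W', ∀ z ∈ Z' \ {y}, w ∉ Fm z

/-- `y` is topologically essential with respect to the covering of `W'` by `{Fm z}_{z ∈ Z'}`. -/
def TopEssential {Z W : Type*} [TopologicalSpace Z] (Fm : Z → Set W) (Z' : Set Z)
    (W' : Set W) (y : Z) : Prop :=
  y ∈ Z' ∧ ∀ U : Set Z, IsOpen U → y ∈ U → ∃ w ∈ W', ∀ z ∈ Z' \ U, w ∉ Fm z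

theorem UpperSemicontinuous.exists_eq_iSup_of_isCompact_closure {Y : Type*} [TopologicalSpace Y]
    {φ : Y → EReal} (hφ : UpperSemicontinuous φ)
    (hc : ∀ β : ℝ, IsCompact (closure {y | (β : EReal) ≤ φ y})) (h : ⊥ < ⨆ y, φ y) :
    ∃ y, φ y = ⨆ z, φ z := by
  obtain ⟨β, -, hβ⟩ := EReal.lt_iff_exists_real_btwn.1 h
  obtain ⟨y₁, hy₁⟩ := lt_iSup_iff.1 hβ
  have hcl : IsClosed {y | (β : EReal) ≤ φ y} := hφ.isClosed_preimage (β : EReal)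
  have hK : IsCompact {y | (β : EReal) ≤ φ y} := hcl.closure_eq ▸ hc β
  obtain ⟨y, hy, hmax⟩ := (hφ.upperSemicontinuousOn _).exists_isMaxOn ⟨y₁, hy₁.le⟩ hK
  refine ⟨y, le_antisymm (le_iSup φ y) (iSup_le fun z => ?_)⟩
  by_cases hz : (β : EReal) ≤ φ z
  · exact hmax hz
  · exact (not_le.1 hz).le.trans hy

section Galois

variable {X Y : Type*} {b : X → Y → EReal → EReal} {bo : Y → X → EReal → EReal}
  {S : Set (X × Y)}

theorem kernel_antitone (hgal : ∀ x y α β, b x y α ≤ β ↔ bo y x β ≤ α) (x : X) (y : Y) :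
    Antitone (b x y) := fun _ _ h =>
  (hgal x y _ _).2 (((hgal x y _ _).1 le_rfl).trans h)

theorem kernel_top (hgal : ∀ x y α β, b x y α ≤ β ↔ bo y x β ≤ α) (x : X) (y : Y) :
    b x y ⊤ = ⊥ :=
  le_bot_iff.1 ((hgal x y _ _).2 le_top)

theorem dual_kernel_kernel (hgal : ∀ x y α β, b x y α ≤ β ↔ bo y x β ≤ α) {x : X} {y : Y}
    (hb : Function.Injective (b x y)) (α : EReal) : bo y x (b x y α) = α :=
  hb (le_antisymm ((hgal x y _ _).2 le_rfl)
    (kernel_antitone hgal x y ((hgal x y _ _).1 le_rfl)))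

theorem kernel_dual_kernel (hgal : ∀ x y α β, b x y α ≤ β ↔ bo y x β ≤ α) {x : X} {y : Y}
    (hb : Function.Bijective (b x y)) (β : EReal) : b x y (bo y x β) = β := by
  obtain ⟨α, rfl⟩ := hb.2 β
  rw [dual_kernel_kernel hgal hb.1]

theorem le_kernel_iff (hgal : ∀ x y α β, b x y α ≤ β ↔ bo y x β ≤ α) {x : X} {y : Y}
    (hb : Function.Bijective (b x y)) {α β : EReal} : β ≤ b x y α ↔ α ≤ bo y x β := by
  obtain ⟨α', rfl⟩ := hb.2 β
  rw [hgal, dual_kernel_kernel hgal hb.1, dual_kernel_kernel hgal hb.1]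

theorem Bop_le_iff (hgal : ∀ x y α β, b x y α ≤ β ↔ bo y x β ≤ α) {f : Y → EReal}
    {g : X → EReal} : (∀ x, Bop b f x ≤ g x) ↔ ∀ y, Bgal bo g y ≤ f y := by
  simp only [Bop, Bgal, iSup_le_iff, hgal]
  exact forall_comm

theorem mem_of_bot_lt_kernel (hS4 : ∀ x y, (x, y) ∉ S → ∀ α : EReal, b x y α = ⊥) {x : X} {y : Y}
    {α : EReal} (h : ⊥ < b x y α) : (x, y) ∈ S := by
  by_contra hn
  exact h.ne' (hS4 x y hn α)

theorem kernel_eq_of_mem_subdiffo (hgal : ∀ x y α β, b x y α ≤ β ↔ bo y x β ≤ α)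
    (hS3 : ∀ x y, (x, y) ∈ S → Function.Bijective (b x y)) {g : X → EReal} {x : X} {y : Y}
    (h : y ∈ subdiffo bo S g x) : b x y (Bgal bo g y) = g x := by
  rw [h.2, kernel_dual_kernel hgal (hS3 x y h.1)]

variable [TopologicalSpace Y]

theorem lowerSemicontinuous_Bgal (hbo_lsc : ∀ x α, LowerSemicontinuous fun y => bo y x α)
    (g : X → EReal) : LowerSemicontinuous (Bgal bo g) :=
  lowerSemicontinuous_iSup fun x => hbo_lsc x (g x)

theorem upperSemicontinuous_kernel_comp (hgal : ∀ x y α β, b x y α ≤ β ↔ bo y x β ≤ α)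
    (hS3 : ∀ x y, (x, y) ∈ S → Function.Bijective (b x y))
    (hS4 : ∀ x y, (x, y) ∉ S → ∀ α : EReal, b x y α = ⊥) {f : Y → EReal}
    (hf : LowerSemicontinuous f)
    (h : DiscreteTopology Y ∨ (Cont2 b ∧ ∀ y, f y ≠ ⊥)) (x : X) :
    UpperSemicontinuous fun y => b x y (f y) := by
  rcases h with h | ⟨hc, hbot⟩
  · exact continuous_of_discreteTopology.upperSemicontinuous
  intro y₀ β hβ
  obtain ⟨α, hα, hαβ⟩ : ∃ α : ℝ, (α : EReal) < f y₀ ∧ b x y₀ α < β := by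
    by_cases hS : (x, y₀) ∈ S
    · have hlt : bo y₀ x β < f y₀ := by
        rw [← not_le] at hβ ⊢
        rwa [← le_kernel_iff hgal (hS3 x y₀ hS)]
      obtain ⟨α, h₁, h₂⟩ := EReal.lt_iff_exists_real_btwn.1 hlt
      refine ⟨α, h₂, ?_⟩
      rw [← not_le] at h₁ ⊢
      rwa [le_kernel_iff hgal (hS3 x y₀ hS)]
    · obtain ⟨α, -, h₂⟩ := EReal.lt_iff_exists_real_btwn.1 (bot_lt_iff_ne_bot.2 (hbot y₀))
      refine ⟨α, h₂, ?_⟩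
      rw [hS4 x y₀ hS]
      exact bot_le.trans_lt hβ
  filter_upwards [hf y₀ _ hα, (hc x α).continuousAt.eventually_lt_const hαβ] with y h₁ h₂
  exact (kernel_antitone hgal x y h₁.le).trans_lt h₂

theorem isSolution_Bgal (hgal : ∀ x y α β, b x y α ≤ β ↔ bo y x β ≤ α)
    (hbo_lsc : ∀ x α, LowerSemicontinuous fun y => bo y x α) {g : X → EReal} {X' : Set X}
    (h : ∀ x ∈ X', g x ≤ Bop b (Bgal bo g) x) : IsSolution b g X' (Bgal bo g) :=
  have hle : ∀ x, Bop b (Bgal bo g) x ≤ g x := (Bop_le_iff hgal).2 fun _ => le_rfl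
  ⟨lowerSemicontinuous_Bgal hbo_lsc g, hle, fun x hx => le_antisymm (hle x) (h x hx)⟩

theorem isSolution_Bgal_of_isSolution (hgal : ∀ x y α β, b x y α ≤ β ↔ bo y x β ≤ α)
    (hbo_lsc : ∀ x α, LowerSemicontinuous fun y => bo y x α) {g : X → EReal} {X' : Set X}
    {f : Y → EReal} (hf : IsSolution b g X' f) : IsSolution b g X' (Bgal bo g) :=
  isSolution_Bgal hgal hbo_lsc fun x hx => (hf.2.2 x hx).symm.le.trans
    (iSup_mono fun y => kernel_antitone hgal x y ((Bop_le_iff hgal).1 hf.2.1 y))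

theorem isSolution_Bgal_of_covering (hgal : ∀ x y α β, b x y α ≤ β ↔ bo y x β ≤ α)
    (hbo_lsc : ∀ x α, LowerSemicontinuous fun y => bo y x α)
    (hS3 : ∀ x y, (x, y) ∈ S → Function.Bijective (b x y)) {g : X → EReal} {X' : Set X}
    (hcov : X' ∩ udom g ⊆ ⋃ y ∈ ldom (Bgal bo g), subdiffoInv bo S g y) :
    IsSolution b g X' (Bgal bo g) := by
  refine isSolution_Bgal hgal hbo_lsc fun x hx => ?_
  rcases eq_bot_or_bot_lt (g x) with h | h
  · simp [h]
  obtain ⟨y, -, hy⟩ := Set.mem_iUnion₂.1 (hcov ⟨hx, h⟩)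
  rw [← kernel_eq_of_mem_subdiffo hgal hS3 hy]
  exact le_iSup (fun y => b x y (Bgal bo g y)) y

open Classical in
theorem topEssential_of_existsUnique (hgal : ∀ x y α β, b x y α ≤ β ↔ bo y x β ≤ α)
    (hbo_lsc : ∀ x α, LowerSemicontinuous fun y => bo y x α)
    (hS3 : ∀ x y, (x, y) ∈ S → Function.Bijective (b x y)) {g : X → EReal} {X' : Set X}
    (hU : ∃! f : Y → EReal, IsSolution b g X' f) {y : Y} (hy : y ∈ ldom (Bgal bo g)) :
    TopEssential (subdiffoInv bo S g) (ldom (Bgal bo g)) (X' ∩ udom g) y := by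
  refine ⟨hy, fun U hU_open hyU => ?_⟩
  by_contra! hcov
  obtain ⟨f₁, hf₁, huniq⟩ := hU
  set f : Y → EReal := fun z => if z ∈ U then ⊤ else Bgal bo g z with hf
  have hle : ∀ x, Bop b f x ≤ g x := (Bop_le_iff hgal).2 fun z => by
    simp only [hf]; split_ifs <;> simp
  have hsol : IsSolution b g X' f := by
    refine ⟨fun z c hc => ?_, hle, fun x hx => le_antisymm (hle x) ?_⟩
    · by_cases hz : z ∈ U
      · filter_upwards [hU_open.mem_nhds hz] with w hw
        simp only [hf, hz, hw, if_true] at hc ⊢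
        exact hc
      · simp only [hf, hz, if_false] at hc
        filter_upwards [lowerSemicontinuous_Bgal hbo_lsc g z c hc] with w hw
        simp only [hf]
        split_ifs
        · exact hc.trans_le le_top
        · exact hw
    · rcases eq_bot_or_bot_lt (g x) with h | h
      · simp [h]
      obtain ⟨z, hz, hxz⟩ := hcov x ⟨hx, h⟩
      rw [← kernel_eq_of_mem_subdiffo hgal hS3 hxz]
      have : f z = Bgal bo g z := if_neg hz.2
      rw [← this]
      exact le_iSup (fun y => b x y (f y)) z
  have heq : f = Bgal bo g := (huniq f hsol).trans
    (huniq _ (isSolution_Bgal_of_isSolution hgal hbo_lsc hf₁)).symm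
  have hfy : f y = ⊤ := if_pos hyU
  exact hy.ne (heq ▸ hfy)

theorem isCompact_closure_superlevel [TopologicalSpace X]
    (hgal : ∀ x y α β, b x y α ≤ β ↔ bo y x β ≤ α)
    (hS3 : ∀ x y, (x, y) ∈ S → Function.Bijective (b x y))
    (hS4 : ∀ x y, (x, y) ∉ S → ∀ α : EReal, b x y α = ⊥) {g : X → EReal} {X' : Set X}
    (hB : MemFc b (Bgal bo g) ∨ (Coercive b bo ∧ X' ⊆ idom g ∪ {x | g x = ⊥}))
    {x : X} (hx : x ∈ X') (hgx : ⊥ < g x) (β : ℝ) :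
    IsCompact (closure {y | (β : EReal) ≤ b x y (Bgal bo g y)}) := by
  rcases hB with hB | ⟨hcoer, hX'⟩
  · exact hB x β
  have hlim : Filter.limsup g (nhds x) < ⊤ := (hX' hx).elim (fun h => h.2) fun h => absurd h hgx.ne'
  obtain ⟨M, hM, -⟩ := EReal.lt_iff_exists_real_btwn.1 hlim
  have hV : {z | g z < M} ∈ nhds x := Filter.eventually_lt_of_limsup_lt hM
  refine (hcoer x _ hV β M).of_isClosed_subset isClosed_closure (closure_mono fun y hy => ?_)
  have hxy : (x, y) ∈ S := mem_of_bot_lt_kernel hS4 ((EReal.bot_lt_coe β).trans_le hy)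
  change (⨆ z ∈ {z | g z < M}, b z y (bo y x β)) ≤ M
  refine iSup₂_le fun z hz => ?_
  calc b z y (bo y x β) ≤ b z y (Bgal bo g y) :=
        kernel_antitone hgal z y ((le_kernel_iff hgal (hS3 x y hxy)).1 hy)
    _ ≤ g z := (hgal z y _ _).2 (le_iSup (fun x => bo y x (g x)) z)
    _ ≤ M := hz.le

theorem exists_mem_subdiffo_of_isSolution [TopologicalSpace X]
    (hgal : ∀ x y α β, b x y α ≤ β ↔ bo y x β ≤ α)
    (hS3 : ∀ x y, (x, y) ∈ S → Function.Bijective (b x y))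
    (hS4 : ∀ x y, (x, y) ∉ S → ∀ α : EReal, b x y α = ⊥) {g : X → EReal} {X' : Set X}
    (hA : DiscreteTopology Y ∨ (Cont2 b ∧ ∀ y : Y, Bgal bo g y ≠ ⊥))
    (hB : MemFc b (Bgal bo g) ∨ (Coercive b bo ∧ X' ⊆ idom g ∪ {x | g x = ⊥}))
    {f : Y → EReal} (hf : IsSolution b g X' f) {x : X} (hx : x ∈ X') (hgx : ⊥ < g x) :
    ∃ y ∈ ldom (Bgal bo g), y ∈ subdiffo bo S g x ∧ f y = Bgal bo g y := by
  have hle : ∀ y, Bgal bo g y ≤ f y := (Bop_le_iff hgal).1 hf.2.1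
  have husc := upperSemicontinuous_kernel_comp hgal hS3 hS4 hf.1
    (hA.imp_right fun h => ⟨h.1, fun y hy => h.2 y (le_bot_iff.1 (hy ▸ hle y))⟩) x
  have hsup : ⨆ y, b x y (f y) = g x := hf.2.2 x hx
  obtain ⟨y, hy⟩ := husc.exists_eq_iSup_of_isCompact_closure
    (fun β => (isCompact_closure_superlevel hgal hS3 hS4 hB hx hgx β).of_isClosed_subset
      isClosed_closure (closure_mono fun y (h : _ ≤ _) =>
        h.trans (kernel_antitone hgal x y (hle y)))) (hsup ▸ hgx)
  rw [hsup] at hy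
  have hxy : (x, y) ∈ S := mem_of_bot_lt_kernel hS4 (hy ▸ hgx)
  have hfy : f y = bo y x (g x) := by rw [← hy, dual_kernel_kernel hgal (hS3 x y hxy).1]
  have heq : f y = Bgal bo g y :=
    le_antisymm (hfy ▸ le_iSup (fun x => bo y x (g x)) x) (hle y)
  have hy_dom : Bgal bo g y ≠ ⊤ := fun h => hgx.ne' <| by
    rw [← hy, heq, h, kernel_top hgal]
  exact ⟨y, hy_dom.lt_top, ⟨hxy, heq.symm.trans hfy⟩, heq⟩

theorem covering_of_isSolution [TopologicalSpace X]
    (hgal : ∀ x y α β, b x y α ≤ β ↔ bo y x β ≤ α)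
    (hS3 : ∀ x y, (x, y) ∈ S → Function.Bijective (b x y))
    (hS4 : ∀ x y, (x, y) ∉ S → ∀ α : EReal, b x y α = ⊥) {g : X → EReal} {X' : Set X}
    (hA : DiscreteTopology Y ∨ (Cont2 b ∧ ∀ y : Y, Bgal bo g y ≠ ⊥))
    (hB : MemFc b (Bgal bo g) ∨ (Coercive b bo ∧ X' ⊆ idom g ∪ {x | g x = ⊥}))
    {f : Y → EReal} (hf : IsSolution b g X' f) :
    X' ∩ udom g ⊆ ⋃ y ∈ ldom (Bgal bo g), subdiffoInv bo S g y := fun _ hx =>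
  let ⟨y, hy, hxy, _⟩ := exists_mem_subdiffo_of_isSolution hgal hS3 hS4 hA hB hf hx.1 hx.2
  Set.mem_iUnion₂.2 ⟨y, hy, hxy⟩

theorem isSolution_eq_Bgal [TopologicalSpace X]
    (hgal : ∀ x y α β, b x y α ≤ β ↔ bo y x β ≤ α)
    (hS3 : ∀ x y, (x, y) ∈ S → Function.Bijective (b x y))
    (hS4 : ∀ x y, (x, y) ∉ S → ∀ α : EReal, b x y α = ⊥) {g : X → EReal} {X' : Set X}
    (hA : DiscreteTopology Y ∨ (Cont2 b ∧ ∀ y : Y, Bgal bo g y ≠ ⊥))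
    (hB : MemFc b (Bgal bo g) ∨ (Coercive b bo ∧ X' ⊆ idom g ∪ {x | g x = ⊥}))
    (hQ : QuasiContinuousOnDom (Bgal bo g))
    (hM : ∀ y ∈ ldom (Bgal bo g),
      TopEssential (subdiffoInv bo S g) (ldom (Bgal bo g)) (X' ∩ udom g) y)
    {f : Y → EReal} (hf : IsSolution b g X' f) : f = Bgal bo g := by
  have hle : ∀ y, Bgal bo g y ≤ f y := (Bop_le_iff hgal).1 hf.2.1
  have hdense : ∀ y ∈ ldom (Bgal bo g), ∀ U : Set Y, IsOpen U → y ∈ U →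
      ∃ z ∈ U, z ∈ ldom (Bgal bo g) ∧ f z = Bgal bo g z := by
    intro y hy U hU hyU
    obtain ⟨x, hx, hxU⟩ := (hM y hy).2 U hU hyU
    obtain ⟨z, hz, hxz, hfz⟩ :=
      exists_mem_subdiffo_of_isSolution hgal hS3 hS4 hA hB hf hx.1 hx.2
    exact ⟨z, by_contra fun h => hxU z ⟨hz, h⟩ hxz, hz, hfz⟩
  funext y₀
  by_contra hne
  have hlt : Bgal bo g y₀ < f y₀ := lt_of_le_of_ne (hle y₀) (Ne.symm hne)
  have hldom : y₀ ∈ ldom (Bgal bo g) := hlt.trans_le le_top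
  rcases hA with hA | ⟨-, hbot⟩
  · obtain ⟨z, rfl, -, hfz⟩ := hdense y₀ hldom {y₀} (isOpen_discrete _) rfl
    exact hne hfz
  obtain ⟨c, hc₁, hc₂⟩ := exists_between hlt
  have hU : IsOpen {y | c < f y} := hf.1.isOpen_preimage c
  let p₀ : edom (Bgal bo g) := ⟨y₀, hldom, bot_lt_iff_ne_bot.2 (hbot y₀)⟩
  have hp₀ : p₀ ∈ closure (interior ((fun z : edom (Bgal bo g) => Bgal bo g z.1) ⁻¹' Set.Iio c)) :=
    hQ (Set.Iio c) isOpen_Iio hc₁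
  obtain ⟨p, hpU, hpint⟩ := mem_closure_iff.1 hp₀ _ (hU.preimage continuous_subtype_val) hc₂
  obtain ⟨W, hW, hWeq⟩ := isOpen_induced_iff.1
    (isOpen_interior (s := (fun z : edom (Bgal bo g) => Bgal bo g z.1) ⁻¹' Set.Iio c))
  have hpW : p.1 ∈ W := by rw [← hWeq] at hpint; exact hpint
  obtain ⟨z, ⟨hzU, hzW⟩, hz, hfz⟩ := hdense p.1 p.2.1 _ (hU.inter hW) ⟨hpU, hpW⟩
  let q : edom (Bgal bo g) := ⟨z, hz, bot_lt_iff_ne_bot.2 (hbot z)⟩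
  have hq : q ∈ interior ((fun z : edom (Bgal bo g) => Bgal bo g z.1) ⁻¹' Set.Iio c) := by
    rw [← hWeq]; exact hzW
  have hzc : q ∈ (fun z : edom (Bgal bo g) => Bgal bo g z.1) ⁻¹' Set.Iio c := interior_subset hq
  have hcz : c < f z := hzU
  rw [hfz] at hcz
  exact lt_asymm hcz hzc

end Galois

/-- Uniqueness of the solution of Problem (P') versus topological minimality of
the covering. -/
theorem stmt14
    {X Y : Type*} [TopologicalSpace X] [TopologicalSpace Y] [T2Space X] [T2Space Y]
    (b : X → Y → EReal → EReal) (bo : Y → X → EReal → EReal) (S : Set (X × Y))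
    (hgal : ∀ (x : X) (y : Y) (α β : EReal), b x y α ≤ β ↔ bo y x β ≤ α)
    (hbo_lsc : ∀ (x : X) (α : EReal), LowerSemicontinuous fun y => bo y x α)
    (hS1 : ∀ x : X, ∃ y : Y, (x, y) ∈ S)
    (hS2 : ∀ y : Y, ∃ x : X, (x, y) ∈ S)
    (hS3 : ∀ x y, (x, y) ∈ S → Function.Bijective (b x y))
    (hS4 : ∀ x y, (x, y) ∉ S → ∀ α : EReal, b x y α = ⊥)
    (g : X → EReal) (X' : Set X) :
    (((∃! f : Y → EReal, IsSolution b g X' f) ∧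
        X' ∩ udom g ⊆ ⋃ y ∈ ldom (Bgal bo g), subdiffoInv bo S g y) →
      ((X' ∩ udom g ⊆ ⋃ y ∈ ldom (Bgal bo g), subdiffoInv bo S g y) ∧
        ∀ y ∈ ldom (Bgal bo g),
          TopEssential (subdiffoInv bo S g) (ldom (Bgal bo g)) (X' ∩ udom g) y)) ∧
    (((DiscreteTopology Y ∨ (Cont2 b ∧ ∀ y : Y, Bgal bo g y ≠ ⊥)) ∧
      (MemFc b (Bgal bo g) ∨ (Coercive b bo ∧ X' ⊆ idom g ∪ {x | g x = ⊥}))) →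
      ((∃! f : Y → EReal, IsSolution b g X' f) →
        ((X' ∩ udom g ⊆ ⋃ y ∈ ldom (Bgal bo g), subdiffoInv bo S g y) ∧
          ∀ y ∈ ldom (Bgal bo g),
            TopEssential (subdiffoInv bo S g) (ldom (Bgal bo g)) (X' ∩ udom g) y))) ∧
    (((DiscreteTopology Y ∨ (Cont2 b ∧ ∀ y : Y, Bgal bo g y ≠ ⊥)) ∧
      (MemFc b (Bgal bo g) ∨ (Coercive b bo ∧ X' ⊆ idom g ∪ {x | g x = ⊥})) ∧
      QuasiContinuousOnDom (Bgal bo g)) →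
      ((∃! f : Y → EReal, IsSolution b g X' f) ↔
        ((X' ∩ udom g ⊆ ⋃ y ∈ ldom (Bgal bo g), subdiffoInv bo S g y) ∧
          ∀ y ∈ ldom (Bgal bo g),
            TopEssential (subdiffoInv bo S g) (ldom (Bgal bo g)) (X' ∩ udom g) y))) := by
  have hU_imp_M (hcov : X' ∩ udom g ⊆ ⋃ y ∈ ldom (Bgal bo g), subdiffoInv bo S g y)
      (hU : ∃! f : Y → EReal, IsSolution b g X' f) :=
    And.intro hcov fun y (hy : y ∈ ldom (Bgal bo g)) =>
      topEssential_of_existsUnique hgal hbo_lsc hS3 hU hy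
  refine ⟨fun h => hU_imp_M h.2 h.1, fun ⟨hA, hB⟩ hU => ?_, fun ⟨hA, hB, hQ⟩ => ⟨fun hU => ?_, ?_⟩⟩
  · exact hU_imp_M (covering_of_isSolution hgal hS3 hS4 hA hB hU.exists.choose_spec) hU
  · exact hU_imp_M (covering_of_isSolution hgal hS3 hS4 hA hB hU.exists.choose_spec) hU
  · rintro ⟨hcov, hM⟩
    exact ⟨Bgal bo g, isSolution_Bgal_of_covering hgal hbo_lsc hS3 hcov,
      fun f hf => isSolution_eq_Bgal hgal hS3 hS4 hA hB hQ hM hf⟩
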